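/- The quotient A_{n,m}(V) = V/O_{n,m}(V) is an A_n(V)-A_m(V)-bimodule, with left A_n(V)-action induced by ū *̄_m^n v and right A_m(V)-action induced by u *_m^n v. -/

import Mathlib

/-- Generalized binomial coefficient `C(n, k)` for `n : ℤ`, valued in `ℂ`. -/
noncomputable def cbinom (n : ℤ) (k : ℕ) : ℂ :=
  (∏ i ∈ Finset.range k, ((n : ℂ) - (i : ℂ))) / (Nat.factorial k : ℂ)

/-- A vertex operator algebra structure on a complex vector space `V`. -/
structure VOA (V : Type) [AddCommGroup V] [Module ℂ V] where
  mode : V → ℤ → Module.End ℂ V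
  vacuum : V
  conformal : V
  grading : ℤ → Submodule ℂ V
  internal : Function.Bijective (DirectSum.coeLinearMap grading)
  mode_add : ∀ (u v : V) (n : ℤ), mode (u + v) n = mode u n + mode v n
  mode_smul : ∀ (c : ℂ) (u : V) (n : ℤ), mode (c • u) n = c • mode u n
  truncation : ∀ u v : V, ∃ N : ℤ, ∀ n : ℤ, N ≤ n → mode u n v = 0
  vacuum_mem : vacuum ∈ grading 0
  conformal_mem : conformal ∈ grading 2
  vacuum_mode : ∀ (v : V) (n : ℤ), mode vacuum n v = if n = -1 then v else 0
  creation : ∀ (u : V) (n : ℤ), 0 ≤ n → mode u n vacuum = 0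
  creation_neg_one : ∀ u : V, mode u (-1) vacuum = u
  L0_eigen : ∀ (n : ℤ) (u : V), u ∈ grading n → mode conformal 1 u = (n : ℂ) • u
  Lneg1_deriv : ∀ (u : V) (n : ℤ), mode (mode conformal 0 u) n = (-n : ℂ) • mode u (n - 1)
  grading_mode : ∀ (r s m : ℤ) (u v : V), u ∈ grading r → v ∈ grading s →
    mode u m v ∈ grading (r + s - m - 1)
  bounded_below : ∃ N : ℤ, ∀ n : ℤ, n < N → grading n = ⊥
  fin_dim : ∀ n : ℤ, FiniteDimensional ℂ (grading n)
  borcherds : ∀ (p q r : ℤ) (u v w : V),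
    (∑ᶠ i : ℕ, cbinom p i • mode (mode u (r + i) v) (p + q - i) w) =
    ∑ᶠ i : ℕ, ((-1 : ℂ) ^ i * cbinom r i) •
      (mode u (p + r - i) (mode v (q + i) w)
        - (-1 : ℂ) ^ r • mode v (q + r - i) (mode u (p + i) w))

variable {V : Type} [AddCommGroup V] [Module ℂ V]

/-- Projection onto the weight-`n` subspace. -/
noncomputable def VOA.proj (d : VOA V) (n : ℤ) : V →ₗ[ℂ] V :=
  (d.grading n).subtype ∘ₗ (DirectSum.component ℂ ℤ (fun m => d.grading m) n) ∘ₗ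
    (LinearEquiv.ofBijective (DirectSum.coeLinearMap d.grading) d.internal).symm.toLinearMap

/-- `Res_z (1+z)^N z^{-k} Y(u,z)v` for a vector `u` regarded as having weight contribution `N`. -/
noncomputable def VOA.hres (d : VOA V) (N k : ℤ) (u v : V) : V :=
  ∑ᶠ i : ℕ, cbinom N i • d.mode u ((i : ℤ) - k) v

/-- `Res_z (1+z)^{wt u + m} z^{-k} Y(u,z)v`, extended bilinearly from homogeneous `u`. -/
noncomputable def VOA.bres (d : VOA V) (m k : ℤ) (u v : V) : V :=
  ∑ᶠ n : ℤ, d.hres (n + m) k (d.proj n u) v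

/-- The Zhu product `u * v`. -/
noncomputable def VOA.star (d : VOA V) (u v : V) : V := d.bres 0 1 u v

/-- The Zhu circle product `u ∘ v`. -/
noncomputable def VOA.circ (d : VOA V) (u v : V) : V := d.bres 0 2 u v

/-- The subspace `O(V)` spanned by all `u ∘ v`. -/
def VOA.Ozhu (d : VOA V) : Submodule ℂ V := Submodule.span ℂ {w : V | ∃ u v : V, w = d.circ u v}

/-- The product `u ∘_n v`. -/
noncomputable def VOA.circn (d : VOA V) (n : ℕ) (u v : V) : V := d.bres n (2 * n + 2) u v

/-- The product `u *_n v` of Dong–Li–Mason. -/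
noncomputable def VOA.starn (d : VOA V) (n : ℕ) (u v : V) : V :=
  ∑ m ∈ Finset.range (n + 1),
    ((-1 : ℂ) ^ m * cbinom ((m : ℤ) + (n : ℤ)) n) • d.bres n ((n : ℤ) + (m : ℤ) + 1) u v

/-- The subspace `O_n(V)`. -/
def VOA.On (d : VOA V) (n : ℕ) : Submodule ℂ V :=
  Submodule.span ℂ ({w : V | ∃ u v : V, w = d.circn n u v} ∪
    {w : V | ∃ u : V, w = d.mode d.conformal 0 u + d.mode d.conformal 1 u})

/-- The Dong–Jiang product `u *_{m,p}^n v`. -/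
noncomputable def VOA.starmpn (d : VOA V) (m p n : ℕ) (u v : V) : V :=
  ∑ i ∈ Finset.range (p + 1),
    ((-1 : ℂ) ^ i * cbinom ((m : ℤ) + (n : ℤ) - (p : ℤ) + (i : ℤ)) i) •
      d.bres m ((m : ℤ) + (n : ℤ) - (p : ℤ) + (i : ℤ) + 1) u v

/-- The Dong–Jiang product `u ∘_m^n v`. -/
noncomputable def VOA.circmn (d : VOA V) (n m : ℕ) (u v : V) : V :=
  d.bres m ((n : ℤ) + (m : ℤ) + 2) u v

/-- The subspace `O_{n,m}(V) = O'_{n,m}(V) + O''_{n,m}(V) + O'''_{n,m}(V)` of Dong–Jiang. -/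
def VOA.Onm (d : VOA V) (n m : ℕ) : Submodule ℂ V :=
  Submodule.span ℂ (
    {w : V | ∃ u v : V, w = d.circmn n m u v} ∪
    {w : V | ∃ u : V, w = d.mode d.conformal 0 u + d.mode d.conformal 1 u
        + (((m : ℂ) - (n : ℂ)) • u)} ∪
    {w : V | ∃ (u a b c : V) (p₁ p₂ p₃ : ℕ), w = d.starmpn m p₃ n u
        (d.starmpn m p₁ p₃ (d.starmpn p₁ p₂ p₃ a b) c
          - d.starmpn m p₂ p₃ a (d.starmpn m p₁ p₂ b c))} ∪
    {w : V | ∃ (p : ℕ) (u x v : V), x ∈ d.On p ∧ w = d.starmpn m p n (d.starmpn p p n u x) v})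

/-- The subspace `C_2(V)` spanned by the `u_{-2} v`. -/
def VOA.C2 (d : VOA V) : Submodule ℂ V := Submodule.span ℂ {w : V | ∃ u v : V, w = d.mode u (-2) v}

/-- `V` is a simple vertex operator algebra: its only ideals are `0` and `V`. -/
def VOA.IsSimpleVOA (d : VOA V) : Prop :=
  (∃ v : V, v ≠ 0) ∧ ∀ P : Submodule ℂ V,
    (∀ (u : V) (n : ℤ), ∀ w ∈ P, d.mode u n w ∈ P) → P = ⊥ ∨ P = ⊤

/-- A weak module for the vertex operator algebra `d`. -/
structure WeakMod (d : VOA V) (M : Type) [AddCommGroup M] [Module ℂ M] where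
  act : V → ℤ → Module.End ℂ M
  act_add : ∀ (u v : V) (n : ℤ), act (u + v) n = act u n + act v n
  act_smul : ∀ (c : ℂ) (u : V) (n : ℤ), act (c • u) n = c • act u n
  truncation : ∀ (u : V) (w : M), ∃ N : ℤ, ∀ n : ℤ, N ≤ n → act u n w = 0
  vacuum_act : ∀ (w : M) (n : ℤ), act d.vacuum n w = if n = -1 then w else 0
  borcherds : ∀ (p q r : ℤ) (u v : V) (w : M),
    (∑ᶠ i : ℕ, cbinom p i • act (d.mode u (r + i) v) (p + q - i) w) =
    ∑ᶠ i : ℕ, ((-1 : ℂ) ^ i * cbinom r i) •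
      (act u (p + r - i) (act v (q + i) w)
        - (-1 : ℂ) ^ r • act v (q + r - i) (act u (p + i) w))

/-- An admissible (ℤ₊-graded) module for the vertex operator algebra `d`. -/
structure AdmMod (d : VOA V) (M : Type) [AddCommGroup M] [Module ℂ M]
    extends WeakMod d M where
  gr : ℤ → Submodule ℂ M
  gr_internal : Function.Bijective (DirectSum.coeLinearMap gr)
  gr_neg : ∀ n : ℤ, n < 0 → gr n = ⊥
  gr_act : ∀ (r : ℤ) (u : V), u ∈ d.grading r → ∀ (m n : ℤ) (w : M), w ∈ gr n →
    act u m w ∈ gr (r + n - m - 1)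

variable {M : Type} [AddCommGroup M] [Module ℂ M]

/-- The zero-mode `o(v) = v_{wt v - 1}`, extended linearly from homogeneous `v`. -/
noncomputable def WeakMod.o {d : VOA V} (W : WeakMod d M) (v : V) (w : M) : M :=
  ∑ᶠ r : ℤ, W.act (d.proj r v) (r - 1) w

/-- The mode `o_t(v) = v_{wt v - 1 - t}`, extended linearly from homogeneous `v`. -/
noncomputable def WeakMod.ot {d : VOA V} (W : WeakMod d M) (t : ℤ) (v : V) (w : M) : M :=
  ∑ᶠ r : ℤ, W.act (d.proj r v) (r - 1 - t) w

/-- The subspace `Ω_n(M)` of a weak module. -/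
def WeakMod.OmegaSet {d : VOA V} (W : WeakMod d M) (n : ℕ) : Set M :=
  {w : M | ∀ (r : ℤ) (u : V), u ∈ d.grading r → ∀ m : ℤ, m > r - 1 + (n : ℤ) → W.act u m w = 0}

/-- A subspace stable under all modes. -/
def WeakMod.IsStable {d : VOA V} (W : WeakMod d M) (P : Submodule ℂ M) : Prop :=
  ∀ (u : V) (n : ℤ), ∀ w ∈ P, W.act u n w ∈ P

/-- A subspace compatible with the grading of an admissible module. -/
def AdmMod.IsGraded {d : VOA V} (A : AdmMod d M) (P : Submodule ℂ M) : Prop :=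
  P = ⨆ n : ℤ, (P ⊓ A.gr n)

/-- `P` is an irreducible admissible submodule. -/
def AdmMod.IrredSub {d : VOA V} (A : AdmMod d M) (P : Submodule ℂ M) : Prop :=
  P ≠ ⊥ ∧ A.toWeakMod.IsStable P ∧ A.IsGraded P ∧
    ∀ Q : Submodule ℂ M, Q ≤ P → A.toWeakMod.IsStable Q → A.IsGraded Q → Q = ⊥ ∨ Q = P

/-- The admissible module is irreducible. -/
def AdmMod.IsIrreducible {d : VOA V} (A : AdmMod d M) : Prop :=
  (∃ w : M, w ≠ 0) ∧
    ∀ P : Submodule ℂ M, A.toWeakMod.IsStable P → A.IsGraded P → P = ⊥ ∨ P = ⊤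

/-- Rationality: every admissible module is a direct sum of irreducible admissible submodules. -/
def Rational (d : VOA V) : Prop :=
  ∀ (M : Type) [AddCommGroup M] [Module ℂ M] (A : AdmMod d M),
    ∃ (ι : Type) (f : ι → Submodule ℂ M),
      (∀ i, A.IrredSub (f i)) ∧ iSupIndep f ∧ (⨆ i, f i) = ⊤

/-- Equivalence of admissible modules. -/
def AdmEquiv {d : VOA V} {M₁ M₂ : Type} [AddCommGroup M₁] [Module ℂ M₁]
    [AddCommGroup M₂] [Module ℂ M₂] (A₁ : AdmMod d M₁) (A₂ : AdmMod d M₂) : Prop :=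
  ∃ e : M₁ ≃ₗ[ℂ] M₂, ∀ (u : V) (n : ℤ) (w : M₁), e (A₁.act u n w) = A₂.act u n (e w)

/-- An ordinary-module structure on a weak module: a `ℂ`-grading by finite dimensional
`L(0)`-eigenspaces, bounded below in each coset of `ℤ`. -/
structure OrdinaryStruct {d : VOA V} (W : WeakMod d M) where
  grc : ℂ → Submodule ℂ M
  internal : Function.Bijective (DirectSum.coeLinearMap grc)
  eigen : ∀ (lam : ℂ) (w : M), w ∈ grc lam → W.act d.conformal 1 w = lam • w
  findim : ∀ lam : ℂ, FiniteDimensional ℂ (grc lam)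
  bounded : ∀ lam : ℂ, ∃ N : ℤ, ∀ n : ℤ, n < N → grc (lam + (n : ℂ)) = ⊥

/-- An admissible module is ordinary. -/
def AdmMod.IsOrdinary {d : VOA V} (A : AdmMod d M) : Prop :=
  Nonempty (OrdinaryStruct A.toWeakMod)

/-- A realization of the quotient associative algebra `V/Osub` with product induced by `mu`. -/
structure Realization (Osub : Submodule ℂ V) (mu : V → V → V) (one : V) where
  carrier : Type
  [ring : Ring carrier]
  [alg : Algebra ℂ carrier]
  emb : V →ₗ[ℂ] carrier
  surj : Function.Surjective emb
  ker_eq : LinearMap.ker emb = Osub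
  mul_compat : ∀ u v : V, emb (mu u v) = emb u * emb v
  one_compat : emb one = 1

/-- The realized algebra is semisimple. -/
def Realization.Semisimple {Osub : Submodule ℂ V} {mu : V → V → V} {one : V}
    (R : Realization Osub mu one) : Prop :=
  letI := R.ring; IsSemisimpleRing R.carrier

/-- The realized algebra is finite dimensional over `ℂ`. -/
def Realization.FinDim {Osub : Submodule ℂ V} {mu : V → V → V} {one : V}
    (R : Realization Osub mu one) : Prop :=
  letI := R.ring; letI := R.alg; FiniteDimensional ℂ R.carrier

/-- A module over the quotient algebra `V/Osub`, given as a representation of `V`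
killing `Osub` and multiplicative for `mu`. -/
structure RepOf (Osub : Submodule ℂ V) (mu : V → V → V) (one : V)
    (U : Type) [AddCommGroup U] [Module ℂ U] where
  rep : V →ₗ[ℂ] Module.End ℂ U
  kills : ∀ v ∈ Osub, rep v = 0
  mul_compat : ∀ u v : V, rep (mu u v) = rep u * rep v
  one_compat : rep one = 1

/-- Simplicity of such a representation. -/
def RepOf.IsSimple {Osub : Submodule ℂ V} {mu : V → V → V} {one : V}
    {U : Type} [AddCommGroup U] [Module ℂ U] (Z : RepOf Osub mu one U) : Prop :=
  (∃ u : U, u ≠ 0) ∧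
    ∀ P : Submodule ℂ U, (∀ v : V, ∀ x ∈ P, Z.rep v x ∈ P) → P = ⊥ ∨ P = ⊤

/-- Equivalence of two such representations. -/
def RepEquiv {Osub : Submodule ℂ V} {mu : V → V → V} {one : V}
    {U₁ U₂ : Type} [AddCommGroup U₁] [Module ℂ U₁] [AddCommGroup U₂] [Module ℂ U₂]
    (Z₁ : RepOf Osub mu one U₁) (Z₂ : RepOf Osub mu one U₂) : Prop :=
  ∃ e : U₁ ≃ₗ[ℂ] U₂, ∀ (v : V) (x : U₁), e (Z₁.rep v x) = Z₂.rep v (e x)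

open scoped LaurentSeries PowerSeries
open LaurentSeries (hasseDeriv)

/-! ### Generalized binomial coefficients -/

section Binomial

theorem cbinom_zero_right (n : ℤ) : cbinom n 0 = 1 := by simp [cbinom]

theorem succ_mul_cbinom_succ (n : ℤ) (k : ℕ) :
    ((k : ℂ) + 1) * cbinom n (k + 1) = ((n : ℂ) - k) * cbinom n k := by
  have h : ((k : ℂ) + 1) ≠ 0 := Nat.cast_add_one_ne_zero k
  have h' : (Nat.factorial k : ℂ) ≠ 0 := by exact_mod_cast k.factorial_ne_zero
  simp only [cbinom, Finset.prod_range_succ, Nat.factorial_succ]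
  push_cast
  field_simp

theorem succ_mul_cbinom_succ_succ (n : ℤ) (k : ℕ) :
    ((k : ℂ) + 1) * cbinom (n + 1) (k + 1) = ((n : ℂ) + 1) * cbinom n k := by
  have h : ((k : ℂ) + 1) ≠ 0 := Nat.cast_add_one_ne_zero k
  have h' : (Nat.factorial k : ℂ) ≠ 0 := by exact_mod_cast k.factorial_ne_zero
  simp only [cbinom, Finset.prod_range_succ', Nat.factorial_succ]
  push_cast
  have : ∀ i : ℕ, (n : ℂ) + 1 - (i + 1) = n - i := fun i => by ring
  simp only [this]
  field_simp
  ring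

theorem cbinom_succ_succ (n : ℤ) (k : ℕ) :
    cbinom (n + 1) (k + 1) = cbinom n k + cbinom n (k + 1) := by
  have h : ((k : ℂ) + 1) ≠ 0 := Nat.cast_add_one_ne_zero k
  apply mul_left_cancel₀ h
  rw [mul_add, succ_mul_cbinom_succ_succ, succ_mul_cbinom_succ]
  ring

theorem cbinom_zero_succ (k : ℕ) : cbinom 0 (k + 1) = 0 := by
  simp [cbinom, Finset.prod_range_succ']

theorem cbinom_natCast (n k : ℕ) : cbinom n k = n.choose k := by
  induction n generalizing k with
  | zero =>
    cases k with
    | zero => simp [cbinom_zero_right]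
    | succ k => simpa using cbinom_zero_succ k
  | succ n ih =>
    cases k with
    | zero => simp [cbinom_zero_right]
    | succ k =>
      rw [Nat.cast_succ, cbinom_succ_succ, ih, ih, Nat.choose_succ_succ]
      push_cast
      rfl

theorem cast_ringChoose (n : ℤ) (k : ℕ) : ((Ring.choose n k : ℤ) : ℂ) = cbinom n k := by
  have h' : (Nat.factorial k : ℂ) ≠ 0 := by exact_mod_cast k.factorial_ne_zero
  have h := Ring.descPochhammer_eq_factorial_smul_choose n k
  rw [cbinom, eq_div_iff h', mul_comm]
  have h2 := congrArg (Int.cast : ℤ → ℂ) h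
  rw [nsmul_eq_mul] at h2
  push_cast at h2
  rw [← h2]
  clear h h2 h'
  induction k with
  | zero => simp
  | succ k ih =>
    rw [Finset.prod_range_succ, ← ih, descPochhammer_succ_right]
    simp [Polynomial.smeval_mul, Polynomial.smeval_sub, Polynomial.smeval_natCast]

end Binomial

/-! ### The Laurent series `(1 + z) ^ N * z ^ (-k)` -/

section BinomSeries

theorem one_add_X_mul_mk_cbinom (N : ℤ) :
    (1 + PowerSeries.X) * PowerSeries.mk (cbinom N) = PowerSeries.mk (cbinom (N + 1)) := by
  ext k
  rw [add_mul, one_mul, map_add]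
  cases k with
  | zero => simp [cbinom_zero_right]
  | succ k =>
    rw [PowerSeries.coeff_succ_X_mul]
    simp only [PowerSeries.coeff_mk, cbinom_succ_succ]
    ring

theorem mk_cbinom_zero : PowerSeries.mk (cbinom 0) = 1 := by
  ext k
  cases k with
  | zero => simp [cbinom_zero_right]
  | succ k => simp [cbinom_zero_succ, PowerSeries.coeff_one]

theorem mk_cbinom_mul (N M : ℤ) :
    PowerSeries.mk (cbinom N) * PowerSeries.mk (cbinom M) = PowerSeries.mk (cbinom (N + M)) := by
  induction N using Int.induction_on with
  | zero => rw [mk_cbinom_zero, one_mul, zero_add]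
  | succ N ih => rw [← one_add_X_mul_mk_cbinom, mul_assoc, ih, one_add_X_mul_mk_cbinom]; ring_nf
  | pred N ih =>
    have h : (1 + PowerSeries.X : ℂ⟦X⟧) ≠ 0 := fun h => by
      simpa using congrArg PowerSeries.constantCoeff h
    apply mul_left_cancel₀ h
    rw [← mul_assoc, one_add_X_mul_mk_cbinom, one_add_X_mul_mk_cbinom, sub_add_cancel, ih]
    ring_nf

/-- The Laurent series `(1 + z) ^ N * z ^ (-k)`. -/
noncomputable def binomSeries (N k : ℤ) : ℂ⸨X⸩ :=
  HahnSeries.single (-k) 1 * ((PowerSeries.mk (cbinom N) : ℂ⟦X⟧) : ℂ⸨X⸩)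

theorem coeff_binomSeries (N k p : ℤ) :
    (binomSeries N k).coeff p = if p + k < 0 then 0 else cbinom N (p + k).natAbs := by
  rw [binomSeries, HahnSeries.coeff_single_mul, one_mul, sub_neg_eq_add, PowerSeries.coeff_coe,
    PowerSeries.coeff_mk]

theorem coeff_binomSeries_sub (N k : ℤ) (i : ℕ) :
    (binomSeries N k).coeff (i - k) = cbinom N i := by
  simp [coeff_binomSeries]

theorem coeff_binomSeries_of_lt {N k p : ℤ} (h : p < -k) : (binomSeries N k).coeff p = 0 := by
  rw [coeff_binomSeries, if_pos (by omega)]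

theorem binomSeries_mul (N k M l : ℤ) :
    binomSeries N k * binomSeries M l = binomSeries (N + M) (k + l) := by
  have h : HahnSeries.single (-(k + l)) (1 : ℂ)
      = HahnSeries.single (-k) 1 * HahnSeries.single (-l) 1 := by
    rw [HahnSeries.single_mul_single, mul_one, neg_add]
  rw [binomSeries, binomSeries, binomSeries, h, ← mk_cbinom_mul, PowerSeries.coe_mul]
  ring

theorem binomSeries_zero_left (k : ℤ) : binomSeries 0 k = HahnSeries.single (-k) 1 := by
  rw [binomSeries, mk_cbinom_zero, PowerSeries.coe_one, mul_one]

theorem single_mul_binomSeries (p N k : ℤ) :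
    HahnSeries.single p 1 * binomSeries N k = binomSeries N (k - p) := by
  have h := binomSeries_zero_left (-p)
  rw [neg_neg] at h
  rw [← h, binomSeries_mul]
  ring_nf

theorem binomSeries_succ (N k : ℤ) :
    binomSeries (N + 1) k = binomSeries N k + binomSeries N (k - 1) := by
  rw [← single_mul_binomSeries 1 N k]
  simp only [binomSeries]
  rw [← one_add_X_mul_mk_cbinom, PowerSeries.coe_mul, PowerSeries.coe_add, PowerSeries.coe_one,
    PowerSeries.coe_X]
  ring

theorem coeff_hasseDeriv (i : ℕ) (f : ℂ⸨X⸩) (p : ℤ) :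
    (hasseDeriv ℂ i f).coeff p = cbinom (p + i) i * f.coeff (p + i) := by
  rw [LaurentSeries.hasseDeriv_coeff, ← cast_ringChoose, zsmul_eq_mul]

theorem coeff_hasseDeriv_one (f : ℂ⸨X⸩) (p : ℤ) :
    (hasseDeriv ℂ 1 f).coeff p = (p + 1) * f.coeff (p + 1) := by
  rw [coeff_hasseDeriv]
  simp [cbinom]

theorem succ_smul_hasseDeriv_succ (i : ℕ) (f : ℂ⸨X⸩) :
    ((i : ℂ) + 1) • hasseDeriv ℂ (i + 1) f = hasseDeriv ℂ 1 (hasseDeriv ℂ i f) := by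
  ext p
  rw [HahnSeries.coeff_smul, smul_eq_mul, coeff_hasseDeriv_one, coeff_hasseDeriv, coeff_hasseDeriv,
    ← mul_assoc, succ_mul_cbinom_succ]
  push_cast
  rw [show p + 1 + (i : ℤ) = p + (i + 1) by ring]
  ring

theorem hasseDeriv_one_binomSeries (N k : ℤ) :
    hasseDeriv ℂ 1 (binomSeries N k)
      = (N : ℂ) • binomSeries (N - 1) k - (k : ℂ) • binomSeries N (k + 1) := by
  ext p
  rw [coeff_hasseDeriv_one, HahnSeries.coeff_sub, HahnSeries.coeff_smul, HahnSeries.coeff_smul,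
    smul_eq_mul, smul_eq_mul, coeff_binomSeries, coeff_binomSeries, coeff_binomSeries,
    show p + (k + 1) = p + 1 + k by ring]
  rcases lt_trichotomy (p + k + 1) 0 with h | h | h
  · rw [if_pos (by omega), if_pos (by omega)]
    simp
  · rw [if_neg (by omega), if_pos (by omega), show p + 1 + k = 0 by omega]
    have : (p : ℂ) = -1 - k := by rw [show p = -1 - k by omega]; push_cast; ring
    rw [this]
    simp [cbinom_zero_right]
    ring
  · obtain ⟨j, hj⟩ : ∃ j : ℕ, p + k = j := ⟨(p + k).toNat, by omega⟩
    have hp : (p : ℂ) = j - k := by rw [show p = j - k by omega]; push_cast; ring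
    have h1 := succ_mul_cbinom_succ_succ (N - 1) j
    rw [sub_add_cancel] at h1
    push_cast at h1
    rw [if_neg (by omega), if_neg (by omega), show p + 1 + k = ((j + 1 : ℕ) : ℤ) by omega, hj,
      Int.natAbs_natCast, Int.natAbs_natCast, hp]
    linear_combination h1

theorem hasseDeriv_binomSeries_zero (N : ℤ) (i : ℕ) :
    hasseDeriv ℂ i (binomSeries N 0) = cbinom N i • binomSeries (N - i) 0 := by
  induction i with
  | zero => simp [cbinom_zero_right]
  | succ i ih =>
    have h : ((i : ℂ) + 1) ≠ 0 := Nat.cast_add_one_ne_zero i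
    apply smul_right_injective _ h
    simp only
    rw [succ_smul_hasseDeriv_succ, ih, map_smul, hasseDeriv_one_binomSeries, ← mul_smul,
      succ_mul_cbinom_succ]
    push_cast
    have h0 : ∀ f : ℂ⸨X⸩, (0 : ℂ) • f = 0 := fun f => zero_smul ℂ f
    have hm : ∀ (a b : ℂ) (f : ℂ⸨X⸩), a • b • f = (b * a) • f := fun a b f => by
      rw [mul_comm]; exact smul_smul a b f
    rw [h0, sub_zero, hm, sub_sub]

/-- The `i`-th Hasse derivative of `(1 + z) ^ N * z ^ (-k)` is a combination of the series
`(1 + z) ^ (N - i + l) * z ^ (-k - l)` with `l ≤ i`. -/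
theorem hasseDeriv_binomSeries_mem_span (N k : ℤ) (i : ℕ) :
    hasseDeriv ℂ i (binomSeries N k) ∈
      Submodule.span ℂ (Set.range fun l : ℕ => binomSeries (N - i + l) (k + l)) := by
  induction i with
  | zero =>
    apply Submodule.subset_span
    exact ⟨0, by simp⟩
  | succ i ih =>
    have h : ((i : ℂ) + 1) ≠ 0 := Nat.cast_add_one_ne_zero i
    rw [← Submodule.smul_mem_iff _ h, succ_smul_hasseDeriv_succ]
    generalize hasseDeriv ℂ i (binomSeries N k) = f at ih
    induction ih using Submodule.span_induction with
    | mem f hf =>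
      obtain ⟨l, rfl⟩ := hf
      simp only
      rw [hasseDeriv_one_binomSeries]
      refine sub_mem (Submodule.smul_mem _ _ (Submodule.subset_span ⟨l, ?_⟩))
        (Submodule.smul_mem _ _ (Submodule.subset_span ⟨l + 1, ?_⟩)) <;>
      · push_cast
        ring_nf
    | zero => simp
    | add f g _ _ hf hg => rw [map_add]; exact add_mem hf hg
    | smul c f _ hf => rw [map_smul]; exact Submodule.smul_mem _ _ hf

end BinomSeries

/-! ### Residues against Laurent series -/

/-- Laurent series with coefficients vanishing below `K`. -/
def IsSuppGE (K : ℤ) (f : ℂ⸨X⸩) : Prop := ∀ p < K, f.coeff p = 0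

section IsSuppGE

theorem exists_isSuppGE (f : ℂ⸨X⸩) : ∃ K, IsSuppGE K f :=
  ⟨f.order, fun _ hp => HahnSeries.coeff_eq_zero_of_lt_order hp⟩

theorem IsSuppGE.mono {K L : ℤ} {f : ℂ⸨X⸩} (hf : IsSuppGE K f) (h : L ≤ K) : IsSuppGE L f :=
  fun p hp => hf p (hp.trans_le h)

theorem IsSuppGE.mul {K L : ℤ} {f g : ℂ⸨X⸩} (hf : IsSuppGE K f) (hg : IsSuppGE L g) :
    IsSuppGE (K + L) (f * g) := by
  intro p hp
  rw [HahnSeries.coeff_mul]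
  refine Finset.sum_eq_zero fun ij hij => ?_
  rw [Finset.mem_antidiagonal] at hij
  rcases lt_or_ge ij.1 K with h | h
  · rw [hf _ h, zero_mul]
  · rw [hg ij.2 (by have := hij.2.2; omega), mul_zero]

theorem IsSuppGE.hasseDeriv {K : ℤ} {f : ℂ⸨X⸩} (hf : IsSuppGE K f) (i : ℕ) :
    IsSuppGE (K - i) (hasseDeriv ℂ i f) := by
  intro p hp
  rw [coeff_hasseDeriv, hf _ (by omega), mul_zero]

theorem isSuppGE_single (p : ℤ) (c : ℂ) : IsSuppGE p (HahnSeries.single p c) :=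
  fun _ hq => HahnSeries.coeff_single_of_ne hq.ne

theorem isSuppGE_binomSeries (N k : ℤ) : IsSuppGE (-k) (binomSeries N k) :=
  fun _ hp => coeff_binomSeries_of_lt hp

theorem smul_eq_C_mul (c : ℂ) (f : ℂ⸨X⸩) : c • f = HahnSeries.C c * f := by
  ext p
  rw [HahnSeries.C_apply, HahnSeries.coeff_single_mul, sub_zero]
  rfl

theorem smul_series_mul (c : ℂ) (f g : ℂ⸨X⸩) : (c • f) * g = c • (f * g) := by
  rw [smul_eq_C_mul, smul_eq_C_mul, mul_assoc]

theorem series_mul_smul (c : ℂ) (f g : ℂ⸨X⸩) : f * (c • g) = c • (f * g) := by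
  rw [mul_comm, smul_series_mul, mul_comm]

/-- A linear condition on Laurent series satisfied by all monomials of degree at least `K` and by
all series of sufficiently high order is satisfied by all series of order at least `K`. -/
theorem IsSuppGE.induction {P : ℂ⸨X⸩ → Prop} {T K : ℤ} (hT : ∀ f, IsSuppGE T f → P f)
    (hP : ∀ p, K ≤ p → P (HahnSeries.single p 1)) (hadd : ∀ f g, P f → P g → P (f + g))
    (hsmul : ∀ (c : ℂ) f, P f → P (c • f)) {f : ℂ⸨X⸩} (hf : IsSuppGE K f) : P f := by
  have key : ∀ (j : ℕ) (L : ℤ), T ≤ L + j → K ≤ L → ∀ g, IsSuppGE L g → P g := by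
    intro j
    induction j with
    | zero => exact fun L hL _ g hg => hT g (hg.mono (by simpa using hL))
    | succ j ih =>
      intro L hL hK g hg
      have h1 : P (g - HahnSeries.single L (g.coeff L)) := by
        refine ih (L + 1) (by push_cast at hL; omega) (by omega) _ fun p hp => ?_
        rw [HahnSeries.coeff_sub]
        rcases (Int.lt_add_one_iff.mp hp).lt_or_eq with h | rfl
        · rw [hg p h, HahnSeries.coeff_single_of_ne h.ne, sub_zero]
        · rw [HahnSeries.coeff_single_same, sub_self]
      have h2 : P (HahnSeries.single L (g.coeff L)) := by
        have h3 := hsmul (g.coeff L) _ (hP L hK)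
        rwa [smul_eq_C_mul, HahnSeries.C_apply, HahnSeries.single_mul_single, zero_add,
          mul_one] at h3
      simpa using hadd _ _ h1 h2
  exact key (T - K).toNat K (by omega) le_rfl f hf

end IsSuppGE

namespace VOA

theorem mode_zero_left (d : VOA V) (p : ℤ) : d.mode 0 p = 0 := by
  simpa using d.mode_smul 0 0 p

theorem hasFiniteSupport_coeff_smul_mode (d : VOA V) (f : ℂ⸨X⸩) (u v : V) :
    (Function.support fun p : ℤ => f.coeff p • d.mode u p v).Finite := by
  obtain ⟨K, hK⟩ := exists_isSuppGE f
  obtain ⟨T, hT⟩ := d.truncation u v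
  refine (Set.finite_Ico K T).subset fun p hp => ?_
  rw [Function.mem_support] at hp
  refine ⟨?_, ?_⟩
  · by_contra h
    exact hp (by rw [hK p (by omega), zero_smul])
  · by_contra h
    exact hp (by rw [hT p (by omega), smul_zero])

/-- The residue `Res_z f(z) Y(u, z) v` for a Laurent series `f`. -/
noncomputable def res (d : VOA V) (f : ℂ⸨X⸩) : V →ₗ[ℂ] V →ₗ[ℂ] V :=
  LinearMap.mk₂ ℂ (fun u v => ∑ᶠ p : ℤ, f.coeff p • d.mode u p v)
    (fun u u' v => by
      rw [← finsum_add_distrib (d.hasFiniteSupport_coeff_smul_mode f u v)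
        (d.hasFiniteSupport_coeff_smul_mode f u' v)]
      simp only [d.mode_add, LinearMap.add_apply, smul_add])
    (fun c u v => by
      rw [smul_finsum]
      simp only [d.mode_smul, LinearMap.smul_apply, smul_comm c])
    (fun u v v' => by
      rw [← finsum_add_distrib (d.hasFiniteSupport_coeff_smul_mode f u v)
        (d.hasFiniteSupport_coeff_smul_mode f u v')]
      simp only [map_add, smul_add])
    (fun c u v => by
      rw [smul_finsum]
      simp only [map_smul, smul_comm c])

theorem res_apply (d : VOA V) (f : ℂ⸨X⸩) (u v : V) :
    d.res f u v = ∑ᶠ p : ℤ, f.coeff p • d.mode u p v := rfl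

theorem res_add (d : VOA V) (f g : ℂ⸨X⸩) (u v : V) :
    d.res (f + g) u v = d.res f u v + d.res g u v := by
  simp only [res_apply]
  rw [← finsum_add_distrib (d.hasFiniteSupport_coeff_smul_mode f u v)
    (d.hasFiniteSupport_coeff_smul_mode g u v)]
  simp only [HahnSeries.coeff_add, add_smul]

theorem res_smul (d : VOA V) (c : ℂ) (f : ℂ⸨X⸩) (u v : V) :
    d.res (c • f) u v = c • d.res f u v := by
  simp only [res_apply]
  rw [smul_finsum]
  simp only [HahnSeries.coeff_smul, smul_assoc]

/-- `VOA.res` as a linear map in the Laurent series. -/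
noncomputable def resSeries (d : VOA V) (u v : V) : ℂ⸨X⸩ →ₗ[ℂ] V where
  toFun f := d.res f u v
  map_add' f g := d.res_add f g u v
  map_smul' c f := d.res_smul c f u v

theorem res_sub (d : VOA V) (f g : ℂ⸨X⸩) (u v : V) :
    d.res (f - g) u v = d.res f u v - d.res g u v :=
  map_sub (d.resSeries u v) f g

theorem res_zero (d : VOA V) (u v : V) : d.res 0 u v = 0 := map_zero (d.resSeries u v)

theorem res_single (d : VOA V) (p : ℤ) (u v : V) :
    d.res (HahnSeries.single p 1) u v = d.mode u p v := by
  rw [res_apply, finsum_eq_single _ p fun q hq => by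
    rw [HahnSeries.coeff_single_of_ne hq, zero_smul], HahnSeries.coeff_single_same, one_smul]

theorem eventually_res_eq_zero (d : VOA V) (u v : V) :
    ∀ᶠ T in Filter.atTop, ∀ f, IsSuppGE T f → d.res f u v = 0 := by
  obtain ⟨T, hT⟩ := d.truncation u v
  filter_upwards [Filter.eventually_ge_atTop T] with T' hT' f hf
  rw [res_apply]
  refine finsum_eq_zero_of_forall_eq_zero fun p => ?_
  rcases lt_or_ge p T' with h | h
  · rw [hf p h, zero_smul]
  · rw [hT p (hT'.trans h), smul_zero]

theorem eventually_res_mul_eq_zero (d : VOA V) (h : ℂ⸨X⸩) (u v : V) :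
    ∀ᶠ T in Filter.atTop, ∀ f, IsSuppGE T f → d.res (h * f) u v = 0 := by
  obtain ⟨K, hK⟩ := exists_isSuppGE h
  filter_upwards [(Filter.tendsto_atTop_add_const_left _ K Filter.tendsto_id).eventually
    (d.eventually_res_eq_zero u v)] with T hT f hf
  exact hT _ (hK.mul hf)

theorem eventually_res_hasseDeriv_mul_eq_zero (d : VOA V) (i : ℕ) (g : ℂ⸨X⸩) (u v : V) :
    ∀ᶠ T in Filter.atTop, ∀ f, IsSuppGE T f → d.res (hasseDeriv ℂ i f * g) u v = 0 := by
  filter_upwards [(Filter.tendsto_atTop_add_const_right _ (-(i : ℤ)) Filter.tendsto_id).eventually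
    (d.eventually_res_mul_eq_zero g u v)] with T hT f hf
  rw [mul_comm]
  exact hT _ (hf.hasseDeriv i)

theorem hres_eq_res (d : VOA V) (N k : ℤ) (u v : V) :
    d.hres N k u v = d.res (binomSeries N k) u v := by
  have hinj : Function.Injective fun i : ℕ => (i : ℤ) - k := fun i j h => by
    simpa using h
  rw [hres, res_apply]
  have h := finsum_mem_range (f := fun p : ℤ => (binomSeries N k).coeff p • d.mode u p v) hinj
  simp only [coeff_binomSeries_sub] at h
  rw [← h]
  apply finsum_congr
  intro p
  by_cases hp : p ∈ Set.range fun i : ℕ => (i : ℤ) - k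
  · simp [hp]
  · rw [coeff_binomSeries_of_lt, zero_smul]
    · simp
    · by_contra hlt
      exact hp ⟨(p + k).toNat, by simp only; omega⟩

theorem res_hasseDeriv_single_mul_single (d : VOA V) (i : ℕ) (p q : ℤ) (u v : V) :
    d.res (hasseDeriv ℂ i (HahnSeries.single p 1) * HahnSeries.single q 1) u v
      = cbinom p i • d.mode u (p + q - i) v := by
  have h : hasseDeriv ℂ i (HahnSeries.single p 1) * HahnSeries.single q 1
      = cbinom p i • HahnSeries.single (p + q - i) (1 : ℂ) := by
    rw [LaurentSeries.hasseDeriv_single, HahnSeries.single_mul_single, smul_eq_C_mul,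
      HahnSeries.C_apply, HahnSeries.single_mul_single, ← cast_ringChoose, zsmul_eq_mul]
    congr 1
    · congr 1; ring
    · ring
  rw [h, res_smul, res_single]

theorem res_single_mul_single (d : VOA V) (p q : ℤ) (u v : V) :
    d.res (HahnSeries.single p 1 * HahnSeries.single q 1) u v = d.mode u (p + q) v := by
  rw [HahnSeries.single_mul_single, mul_one, res_single]

/-- The Borcherds identity integrated against two Laurent series. -/
theorem borcherds_res (d : VOA V) (r : ℤ) (u v w : V) (f g : ℂ⸨X⸩) {n : ℕ}
    (hn : ∀ i : ℕ, n ≤ i → d.mode u (r + i) v = 0) :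
    ∃ l : ℕ, ∑ i ∈ Finset.range n, d.res (hasseDeriv ℂ i f * g) (d.mode u (r + i) v) w =
      ∑ i ∈ Finset.range (l + 1), ((-1 : ℂ) ^ i * cbinom r i) •
        (d.res (HahnSeries.single (r - i) 1 * f) u (d.res (HahnSeries.single (i : ℤ) 1 * g) v w)
          - (-1 : ℂ) ^ r • d.res (HahnSeries.single (r - i) 1 * g) v
              (d.res (HahnSeries.single (i : ℤ) 1 * f) u w)) := by
  obtain ⟨K, hK⟩ := exists_isSuppGE f
  obtain ⟨L, hL⟩ := exists_isSuppGE g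
  obtain ⟨A, hA⟩ := d.truncation u w
  obtain ⟨B, hB⟩ := d.truncation v w
  refine ⟨(max (A - K) (B - L)).toNat, ?_⟩
  set l := (max (A - K) (B - L)).toNat with hl
  have hl1 : A - K ≤ l := by omega
  have hl2 : B - L ≤ l := by omega
  clear_value l
  have hmono : ∀ p q : ℤ, K ≤ p → L ≤ q →
      ∑ i ∈ Finset.range n, cbinom p i • d.mode (d.mode u (r + i) v) (p + q - i) w =
      ∑ i ∈ Finset.range (l + 1), ((-1 : ℂ) ^ i * cbinom r i) •
        (d.mode u (r - i + p) (d.mode v (i + q) w)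
          - (-1 : ℂ) ^ r • d.mode v (r - i + q) (d.mode u (i + p) w)) := by
    intro p q hp hq
    have h := d.borcherds p q r u v w
    rw [finsum_eq_sum_of_support_subset (s := Finset.range n),
      finsum_eq_sum_of_support_subset (s := Finset.range (l + 1))] at h
    · rw [h]
      refine Finset.sum_congr rfl fun i _ => ?_
      rw [show p + r - i = r - i + p by ring, show q + r - i = r - i + q by ring,
        add_comm q, add_comm p]
    · intro i hi
      by_contra hi'
      simp only [Finset.coe_range, Set.mem_Iio, not_lt] at hi'
      apply hi
      simp only
      rw [hB (q + i) (by omega), hA (p + i) (by omega)]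
      simp
    · intro i hi
      by_contra hi'
      simp only [Finset.coe_range, Set.mem_Iio, not_lt] at hi'
      apply hi
      simp only
      rw [hn i hi', mode_zero_left, LinearMap.zero_apply, smul_zero]
  generalize (-1 : ℂ) ^ r = ε at hmono
  have hcont : ∀ g, ∃ T, ∀ f, IsSuppGE T f →
      ∑ i ∈ Finset.range n, d.res (hasseDeriv ℂ i f * g) (d.mode u (r + i) v) w =
      ∑ i ∈ Finset.range (l + 1), ((-1 : ℂ) ^ i * cbinom r i) •
        (d.res (HahnSeries.single (r - i) 1 * f) u (d.res (HahnSeries.single (i : ℤ) 1 * g) v w)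
          - ε • d.res (HahnSeries.single (r - i) 1 * g) v
              (d.res (HahnSeries.single (i : ℤ) 1 * f) u w)) := by
    intro g
    have h1 := (Filter.eventually_all_finset (Finset.range n)).mpr fun i _ =>
      d.eventually_res_hasseDeriv_mul_eq_zero i g (d.mode u (r + i) v) w
    have h2 := (Filter.eventually_all_finset (Finset.range (l + 1))).mpr fun i _ =>
      d.eventually_res_mul_eq_zero (HahnSeries.single (r - i) 1) u
        (d.res (HahnSeries.single (i : ℤ) 1 * g) v w)
    have h3 := (Filter.eventually_all_finset (Finset.range (l + 1))).mpr fun i _ =>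
      d.eventually_res_mul_eq_zero (HahnSeries.single (i : ℤ) 1) u w
    obtain ⟨T, h1, h2, h3⟩ := (h1.and (h2.and h3)).exists
    refine ⟨T, fun f hf => ?_⟩
    rw [Finset.sum_eq_zero fun i hi => h1 i hi f hf, Finset.sum_eq_zero fun i hi => ?_]
    rw [h2 i hi f hf, h3 i hi f hf]
    simp
  have hcont' : ∀ f, ∃ T, ∀ g, IsSuppGE T g →
      ∑ i ∈ Finset.range n, d.res (hasseDeriv ℂ i f * g) (d.mode u (r + i) v) w =
      ∑ i ∈ Finset.range (l + 1), ((-1 : ℂ) ^ i * cbinom r i) •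
        (d.res (HahnSeries.single (r - i) 1 * f) u (d.res (HahnSeries.single (i : ℤ) 1 * g) v w)
          - ε • d.res (HahnSeries.single (r - i) 1 * g) v
              (d.res (HahnSeries.single (i : ℤ) 1 * f) u w)) := by
    intro f
    have h1 := (Filter.eventually_all_finset (Finset.range n)).mpr fun i _ =>
      d.eventually_res_mul_eq_zero (hasseDeriv ℂ i f) (d.mode u (r + i) v) w
    have h2 := (Filter.eventually_all_finset (Finset.range (l + 1))).mpr fun i _ =>
      d.eventually_res_mul_eq_zero (HahnSeries.single (r - i) 1) v
        (d.res (HahnSeries.single (i : ℤ) 1 * f) u w)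
    have h3 := (Filter.eventually_all_finset (Finset.range (l + 1))).mpr fun i _ =>
      d.eventually_res_mul_eq_zero (HahnSeries.single (i : ℤ) 1) v w
    obtain ⟨T, h1, h2, h3⟩ := (h1.and (h2.and h3)).exists
    refine ⟨T, fun g hg => ?_⟩
    rw [Finset.sum_eq_zero fun i hi => h1 i hi g hg, Finset.sum_eq_zero fun i hi => ?_]
    rw [h2 i hi g hg, h3 i hi g hg]
    simp
  obtain ⟨T, hT⟩ := hcont g
  refine IsSuppGE.induction hT ?_ ?_ ?_ hK
  · intro p hp
    obtain ⟨T', hT'⟩ := hcont' (HahnSeries.single p 1)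
    refine IsSuppGE.induction hT' ?_ ?_ ?_ hL
    · intro q hq
      simpa only [res_hasseDeriv_single_mul_single, res_single_mul_single] using hmono p q hp hq
    · intro g g' hg hg'
      simp only [mul_add, res_add, Finset.sum_add_distrib, map_add]
      rw [hg, hg', ← Finset.sum_add_distrib]
      exact Finset.sum_congr rfl fun i _ => by module
    · intro c g hg
      simp only [series_mul_smul, res_smul, ← Finset.smul_sum, map_smul]
      rw [hg, Finset.smul_sum]
      exact Finset.sum_congr rfl fun i _ => by module
  · intro f f' hf hf'
    simp only [mul_add, add_mul, res_add, Finset.sum_add_distrib, map_add]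
    rw [hf, hf', ← Finset.sum_add_distrib]
    exact Finset.sum_congr rfl fun i _ => by module
  · intro c f hf
    simp only [map_smul, smul_series_mul, series_mul_smul, res_smul, ← Finset.smul_sum]
    rw [hf, Finset.smul_sum]
    exact Finset.sum_congr rfl fun i _ => by module

end VOA

/-! ### Grading and bilinearity of the products -/

namespace VOA

theorem proj_of_mem (d : VOA V) {w : ℤ} {u : V} (hu : u ∈ d.grading w) (k : ℤ) :
    d.proj k u = if k = w then u else 0 := by
  have h : (LinearEquiv.ofBijective (DirectSum.coeLinearMap d.grading) d.internal).symm u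
      = DirectSum.lof ℂ ℤ (fun k => d.grading k) w ⟨u, hu⟩ := by
    rw [LinearEquiv.symm_apply_eq, LinearEquiv.ofBijective_apply, DirectSum.coeLinearMap_lof]
  simp only [proj, LinearMap.comp_apply, LinearEquiv.coe_coe, h]
  split_ifs with hk
  · subst hk
    rw [DirectSum.component.lof_self]
    rfl
  · rw [DirectSum.component.of, dif_neg (fun h => hk h.symm), map_zero]

theorem finite_support_proj (d : VOA V) (u : V) :
    (Function.support fun k : ℤ => d.proj k u).Finite := by
  classical
  set x := (LinearEquiv.ofBijective (DirectSum.coeLinearMap d.grading) d.internal).symm u with hx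
  refine (DFinsupp.support x).finite_toSet.subset fun k hk => ?_
  simp only [Function.mem_support, proj, LinearMap.comp_apply, LinearEquiv.coe_coe, ← hx] at hk
  simp only [Finset.mem_coe, DFinsupp.mem_support_iff]
  intro h
  apply hk
  rw [DirectSum.apply_eq_component ℂ] at h
  rw [h, map_zero]

/-- To prove a linear condition on vectors it is enough to check homogeneous ones. -/
theorem homogeneous_induction (d : VOA V) {P : V → Prop}
    (hom : ∀ (w : ℤ) (u : V), u ∈ d.grading w → P u)
    (add : ∀ u v, P u → P v → P (u + v)) (u : V) : P u := by
  have h : u ∈ iSup d.grading := by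
    rw [DirectSum.IsInternal.submodule_iSup_eq_top d.internal]
    trivial
  exact Submodule.iSup_induction _ (motive := P) h hom (hom 0 0 (zero_mem _)) add

/-- The product `VOA.bres` as a bilinear map. -/
noncomputable def bresBilin (d : VOA V) (m k : ℤ) : V →ₗ[ℂ] V →ₗ[ℂ] V :=
  LinearMap.mk₂ ℂ (fun u v => d.bres m k u v)
    (fun u u' v => by
      simp only [bres, hres_eq_res, map_add, LinearMap.add_apply]
      refine finsum_add_distrib ((d.finite_support_proj u).subset fun n hn h => hn ?_)
        ((d.finite_support_proj u').subset fun n hn h => hn ?_) <;>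
      · simp only at h ⊢
        rw [h, map_zero, LinearMap.zero_apply])
    (fun c u v => by
      simp only [bres, hres_eq_res, map_smul, LinearMap.smul_apply]
      rw [smul_finsum])
    (fun u v v' => by
      simp only [bres, hres_eq_res, map_add]
      refine finsum_add_distrib ((d.finite_support_proj u).subset fun n hn h => hn ?_)
        ((d.finite_support_proj u).subset fun n hn h => hn ?_) <;>
      · simp only at h ⊢
        rw [h, map_zero, LinearMap.zero_apply])
    (fun c u v => by
      simp only [bres, hres_eq_res, map_smul]
      rw [smul_finsum])

theorem bresBilin_apply (d : VOA V) (m k : ℤ) (u v : V) :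
    d.bresBilin m k u v = d.bres m k u v := rfl

theorem bres_of_mem (d : VOA V) (m k : ℤ) {w : ℤ} {u : V} (hu : u ∈ d.grading w) (v : V) :
    d.bres m k u v = d.res (binomSeries (w + m) k) u v := by
  rw [bres, finsum_eq_single _ w fun n hn => ?_, d.proj_of_mem hu, if_pos rfl, hres_eq_res]
  rw [d.proj_of_mem hu, if_neg hn, hres_eq_res, map_zero, LinearMap.zero_apply]

/-- The product `VOA.starmpn` as a bilinear map. -/
noncomputable def star₂ (d : VOA V) (m p n : ℕ) : V →ₗ[ℂ] V →ₗ[ℂ] V :=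
  ∑ i ∈ Finset.range (p + 1),
    ((-1 : ℂ) ^ i * cbinom ((m : ℤ) + (n : ℤ) - (p : ℤ) + (i : ℤ)) i) •
      d.bresBilin m ((m : ℤ) + (n : ℤ) - (p : ℤ) + (i : ℤ) + 1)

theorem starmpn_eq (d : VOA V) (m p n : ℕ) (u v : V) : d.starmpn m p n u v = d.star₂ m p n u v := by
  simp only [starmpn, star₂, LinearMap.sum_apply, LinearMap.smul_apply, bresBilin_apply]

theorem starn_eq (d : VOA V) (n : ℕ) (u v : V) : d.starn n u v = d.star₂ n n n u v := by
  rw [starn, ← starmpn_eq, starmpn]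
  refine Finset.sum_congr rfl fun i _ => ?_
  rw [show (n : ℤ) + n - n + i = n + i by ring, add_comm (i : ℤ) n, ← Nat.cast_add,
    cbinom_natCast, cbinom_natCast, Nat.choose_symm_add]

theorem left_apply (d : VOA V) (m n : ℕ) {w : ℤ} {u : V} (hu : u ∈ d.grading w) (v : V) :
    d.star₂ m n n u v = ∑ i ∈ Finset.range (n + 1), ((-1 : ℂ) ^ i * (m + i).choose i) •
      d.res (binomSeries (w + m) (m + i + 1)) u v := by
  rw [← starmpn_eq, starmpn]
  refine Finset.sum_congr rfl fun i _ => ?_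
  rw [d.bres_of_mem _ _ hu, show (m : ℤ) + n - n + i = m + i by ring, ← Nat.cast_add,
    cbinom_natCast]

theorem right_apply (d : VOA V) (m n : ℕ) {w : ℤ} {u : V} (hu : u ∈ d.grading w) (v : V) :
    d.star₂ m m n u v = ∑ i ∈ Finset.range (m + 1), ((-1 : ℂ) ^ i * (n + i).choose i) •
      d.res (binomSeries (w + m) (n + i + 1)) u v := by
  rw [← starmpn_eq, starmpn]
  refine Finset.sum_congr rfl fun i _ => ?_
  rw [d.bres_of_mem _ _ hu, show (m : ℤ) + n - m + i = n + i by ring, ← Nat.cast_add,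
    cbinom_natCast]

/-- The sum defining the vacuum products telescopes to its last term. -/
theorem sum_neg_one_pow_mul_choose_smul (q M : ℕ) (x : ℕ → V) :
    ∑ i ∈ Finset.range (M + 1), ((-1 : ℂ) ^ i * (q + i).choose i) •
      ((i : ℂ) • x i + ((q : ℂ) + i + 1) • x (i + 1))
      = ((-1 : ℂ) ^ M * (q + M).choose M * (q + M + 1)) • x (M + 1) := by
  induction M with
  | zero => simp
  | succ M ih =>
    have h : ((M : ℂ) + 1) * (q + (M + 1)).choose (M + 1) = (q + M + 1) * (q + M).choose M := by
      have := Nat.add_one_mul_choose_eq (q + M) M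
      rw [← add_assoc]
      exact_mod_cast (mul_comm _ _).trans this.symm
    rw [Finset.sum_range_succ, ih, smul_add, ← add_assoc, smul_smul, ← add_smul, smul_smul]
    have h0 : (-1 : ℂ) ^ M * (q + M).choose M * (q + M + 1)
        + (-1) ^ (M + 1) * (q + (M + 1)).choose (M + 1) * ((M + 1 : ℕ) : ℂ) = 0 := by
      push_cast
      linear_combination (-1 : ℂ) ^ (M + 1) * h
    rw [h0, zero_smul, zero_add]

/-! ### Commutation with the conformal vector -/

theorem commutator (d : VOA V) (p q : ℤ) (u v w : V) :
    ∑ᶠ i : ℕ, cbinom p i • d.mode (d.mode u i v) (p + q - i) w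
      = d.mode u p (d.mode v q w) - d.mode v q (d.mode u p w) := by
  have h := d.borcherds p q 0 u v w
  rw [finsum_eq_single (fun i : ℕ => ((-1 : ℂ) ^ i * cbinom 0 i) • _) 0 fun i hi => ?_] at h
  · simpa [cbinom_zero_right] using h
  · obtain ⟨j, rfl⟩ := Nat.exists_eq_succ_of_ne_zero hi
    rw [Nat.succ_eq_add_one, cbinom_zero_succ, mul_zero, zero_smul]

theorem mode_conformal_zero_comm (d : VOA V) (q : ℤ) (v w : V) :
    d.mode d.conformal 0 (d.mode v q w)
      = d.mode v q (d.mode d.conformal 0 w) - (q : ℂ) • d.mode v (q - 1) w := by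
  have h := d.commutator 0 q d.conformal v w
  rw [finsum_eq_single _ 0 fun i hi => ?_] at h
  · rw [sub_eq_iff_eq_add.mp h.symm, Nat.cast_zero, d.Lneg1_deriv, cbinom_zero_right]
    simp only [zero_add, sub_zero, LinearMap.smul_apply]
    module
  · obtain ⟨j, rfl⟩ := Nat.exists_eq_succ_of_ne_zero hi
    rw [Nat.succ_eq_add_one, cbinom_zero_succ, zero_smul]

theorem mode_conformal_one_comm (d : VOA V) (q : ℤ) {a : ℤ} {v : V} (hv : v ∈ d.grading a)
    (w : V) : d.mode d.conformal 1 (d.mode v q w)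
      = d.mode v q (d.mode d.conformal 1 w) + ((a : ℂ) - q - 1) • d.mode v q w := by
  have h := d.commutator 1 q d.conformal v w
  rw [finsum_eq_sum_of_support_subset (s := Finset.range 2)] at h
  · rw [sub_eq_iff_eq_add.mp h.symm, Finset.sum_range_succ, Finset.sum_range_one, Nat.cast_zero,
      Nat.cast_one, d.Lneg1_deriv, d.L0_eigen a v hv, d.mode_smul, cbinom_zero_right,
      show (1 : ℤ) = (1 : ℕ) from rfl, cbinom_natCast]
    simp only [LinearMap.smul_apply]
    push_cast
    rw [show (1 : ℤ) + q - 0 - 1 = q by ring, show (1 : ℤ) + q - 1 = q by ring]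
    simp only [Nat.choose_self]
    push_cast
    module
  · intro i hi
    by_contra hi'
    simp only [Finset.coe_range, Set.mem_Iio, not_lt] at hi'
    apply hi
    simp only
    rw [show (1 : ℤ) = (1 : ℕ) from rfl, cbinom_natCast, Nat.choose_eq_zero_of_lt (by omega),
      Nat.cast_zero, zero_smul]

theorem res_mode_conformal_zero (d : VOA V) (f : ℂ⸨X⸩) (u v : V) :
    d.res f (d.mode d.conformal 0 u) v = -d.res (hasseDeriv ℂ 1 f) u v := by
  rw [res_apply, res_apply, ← finsum_neg_distrib, ← finsum_comp_equiv (Equiv.addRight (1 : ℤ))]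
  refine finsum_congr fun p => ?_
  rw [Equiv.coe_addRight, d.Lneg1_deriv, coeff_hasseDeriv_one, add_sub_cancel_right,
    LinearMap.smul_apply]
  push_cast
  module

theorem mode_conformal_zero_res (d : VOA V) (f : ℂ⸨X⸩) (u v : V) :
    d.mode d.conformal 0 (d.res f u v)
      = d.res f u (d.mode d.conformal 0 v) - d.res (hasseDeriv ℂ 1 f) u v := by
  have h1 := d.eventually_res_eq_zero u v
  have h2 := d.eventually_res_eq_zero u (d.mode d.conformal 0 v)
  have h3 := d.eventually_res_hasseDeriv_mul_eq_zero 1 1 u v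
  obtain ⟨T, h1, h2, h3⟩ := (h1.and (h2.and h3)).exists
  obtain ⟨K, hK⟩ := exists_isSuppGE f
  refine IsSuppGE.induction (T := T) (P := fun f => d.mode d.conformal 0 (d.res f u v)
      = d.res f u (d.mode d.conformal 0 v) - d.res (hasseDeriv ℂ 1 f) u v)
    (fun f hf => ?_) (fun p _ => ?_) (fun f g hf hg => ?_) (fun c f hf => ?_) hK
  · rw [h1 f hf, h2 f hf, ← mul_one (hasseDeriv ℂ 1 f), h3 f hf]
    simp
  · have h := d.res_hasseDeriv_single_mul_single 1 p 0 u v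
    rw [HahnSeries.single_zero_one, mul_one] at h
    rw [res_single, res_single, h, mode_conformal_zero_comm]
    simp [cbinom]
  · simp only [res_add, map_add, hf, hg]
    abel
  · simp only [res_smul, map_smul, hf, smul_sub]

theorem mode_conformal_one_res (d : VOA V) (f : ℂ⸨X⸩) {a : ℤ} {u : V} (hu : u ∈ d.grading a)
    (v : V) : d.mode d.conformal 1 (d.res f u v)
      = d.res f u (d.mode d.conformal 1 v)
        - d.res (hasseDeriv ℂ 1 (HahnSeries.single 1 1 * f)) u v + (a : ℂ) • d.res f u v := by
  have h1 := d.eventually_res_eq_zero u v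
  have h2 := d.eventually_res_eq_zero u (d.mode d.conformal 1 v)
  have h3 := d.eventually_res_hasseDeriv_mul_eq_zero 1 1 u v
  obtain ⟨T, h1, h2, h3⟩ := (h1.and (h2.and h3)).exists
  obtain ⟨K, hK⟩ := exists_isSuppGE f
  refine IsSuppGE.induction (T := T) (P := fun f => d.mode d.conformal 1 (d.res f u v)
      = d.res f u (d.mode d.conformal 1 v)
        - d.res (hasseDeriv ℂ 1 (HahnSeries.single 1 1 * f)) u v + (a : ℂ) • d.res f u v)
    (fun f hf => ?_) (fun p _ => ?_) (fun f g hf hg => ?_)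
    (fun c f hf => ?_) hK
  · rw [h1 f hf, h2 f hf, ← mul_one (hasseDeriv ℂ 1 _),
      h3 _ (((isSuppGE_single 1 1).mul hf).mono (by omega))]
    simp
  · have h := d.res_hasseDeriv_single_mul_single 1 (1 + p) 0 u v
    rw [HahnSeries.single_zero_one, mul_one] at h
    rw [res_single, res_single, HahnSeries.single_mul_single, mul_one, h,
      d.mode_conformal_one_comm p hu]
    simp only [cbinom, Finset.range_one, Finset.prod_singleton, Nat.factorial_one]
    push_cast
    rw [show 1 + p + 0 - 1 = p by ring]
    module
  · simp only [mul_add, res_add, map_add, hf, hg, smul_add]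
    abel
  · simp only [series_mul_smul, res_smul, map_smul, hf]
    module

/-! ### The generators of `Onm` -/

theorem circmn_mem_Onm (d : VOA V) (n m : ℕ) (u v : V) : d.circmn n m u v ∈ d.Onm n m :=
  Submodule.subset_span (Or.inl (Or.inl (Or.inl ⟨u, v, rfl⟩)))

theorem translation_mem_Onm (d : VOA V) (n m : ℕ) (u : V) :
    d.mode d.conformal 0 u + d.mode d.conformal 1 u + ((m : ℂ) - n) • u ∈ d.Onm n m :=
  Submodule.subset_span (Or.inl (Or.inl (Or.inr ⟨u, rfl⟩)))

theorem assoc_mem_Onm (d : VOA V) (n m : ℕ) (u a b c : V) (p₁ p₂ p₃ : ℕ) :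
    d.star₂ m p₃ n u (d.star₂ m p₁ p₃ (d.star₂ p₁ p₂ p₃ a b) c
      - d.star₂ m p₂ p₃ a (d.star₂ m p₁ p₂ b c)) ∈ d.Onm n m := by
  simp only [← starmpn_eq]
  exact Submodule.subset_span (Or.inl (Or.inr ⟨u, a, b, c, p₁, p₂, p₃, rfl⟩))

theorem mul_On_mul_mem_Onm (d : VOA V) (n m : ℕ) {p : ℕ} (u v : V) {x : V} (hx : x ∈ d.On p) :
    d.star₂ m p n (d.star₂ p p n u x) v ∈ d.Onm n m := by
  simp only [← starmpn_eq]
  exact Submodule.subset_span (Or.inr ⟨p, u, x, v, hx, rfl⟩)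

theorem mode_conformal_zero_mem_grading (d : VOA V) {w : ℤ} {u : V} (hu : u ∈ d.grading w) :
    d.mode d.conformal 0 u ∈ d.grading (w + 1) := by
  have h := d.grading_mode 2 w 0 _ _ d.conformal_mem hu
  rwa [show 2 + w - 0 - 1 = w + 1 by ring] at h

theorem res_mode_conformal_zero_binomSeries (d : VOA V) (N k : ℤ) (u v : V) :
    d.res (binomSeries (N + 1) k) (d.mode d.conformal 0 u) v
      = (k : ℂ) • d.res (binomSeries N (k + 1)) u v
        + ((k : ℂ) - N - 1) • d.res (binomSeries N k) u v := by
  rw [res_mode_conformal_zero, hasseDeriv_one_binomSeries, res_sub, res_smul, res_smul,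
    add_sub_cancel_right, binomSeries_succ, res_add, add_sub_cancel_right]
  push_cast
  module

theorem res_binomSeries_mem_Onm (d : VOA V) (n m : ℕ) {s t : ℕ} (hst : s ≤ t) {w N k : ℤ}
    {u : V} (hu : u ∈ d.grading w) (v : V) (hN : N = w + m + s) (hk : k = n + m + 2 + t) :
    d.res (binomSeries N k) u v ∈ d.Onm n m := by
  induction s generalizing t N k with
  | zero =>
    clear hst
    rw [Nat.cast_zero, add_zero] at hN
    subst hN
    induction t generalizing w k u with
    | zero =>
      have h := d.circmn_mem_Onm n m u v
      rw [circmn, d.bres_of_mem _ _ hu] at h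
      rwa [hk, Nat.cast_zero, add_zero]
    | succ t ih =>
      have h := ih (d.mode_conformal_zero_mem_grading hu) rfl
      rw [show w + 1 + m = w + m + 1 by ring, res_mode_conformal_zero_binomSeries,
        Submodule.add_mem_iff_left _ (Submodule.smul_mem _ _ (ih hu rfl)),
        Submodule.smul_mem_iff _ (by norm_cast; omega)] at h
      rw [hk]
      push_cast
      rwa [← add_assoc]
  | succ s ih =>
    obtain ⟨t, rfl⟩ : ∃ t', t = t' + 1 := ⟨t - 1, by omega⟩
    rw [hN, Nat.cast_succ, ← add_assoc, binomSeries_succ, res_add]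
    refine add_mem (ih (t := t + 1) (by omega) rfl hk) (ih (t := t) (by omega) rfl ?_)
    rw [hk]
    push_cast
    ring

/-! ### The generators `u ∘ v` and `L(-1)u + (L(0) + m - n)u` under the two actions -/

theorem right_translation_mem_Onm (d : VOA V) (n m : ℕ) (u b : V) :
    d.star₂ m m n (d.mode d.conformal 0 u + d.mode d.conformal 1 u + ((m : ℂ) - n) • u) b
      ∈ d.Onm n m := by
  induction u using d.homogeneous_induction with
  | add u v hu hv =>
    convert add_mem hu hv using 1
    simp only [map_add, smul_add, LinearMap.add_apply]
    abel
  | hom w u hu =>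
    rw [d.L0_eigen w u hu, map_add, map_add, map_smul, map_smul, LinearMap.add_apply,
      LinearMap.add_apply, d.right_apply m n (d.mode_conformal_zero_mem_grading hu),
      LinearMap.smul_apply, LinearMap.smul_apply, d.right_apply m n hu, Finset.smul_sum,
      Finset.smul_sum, ← Finset.sum_add_distrib, ← Finset.sum_add_distrib]
    have h := sum_neg_one_pow_mul_choose_smul n m
      fun i => d.res (binomSeries (w + m) (n + i + 1)) u b
    refine (congrArg (· ∈ d.Onm n m) (Eq.trans (Finset.sum_congr rfl fun i _ => ?_) h)).mpr ?_
    · rw [show w + 1 + (m : ℤ) = w + m + 1 by ring, res_mode_conformal_zero_binomSeries]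
      push_cast
      rw [← add_assoc (n : ℤ) i 1]
      module
    · refine Submodule.smul_mem _ _ (d.res_binomSeries_mem_Onm n m (le_refl 0) hu b (by simp) ?_)
      push_cast
      ring

theorem left_translation_mem_Onm (d : VOA V) (n m : ℕ) (a u : V) :
    d.star₂ m n n a (d.mode d.conformal 0 u + d.mode d.conformal 1 u + ((m : ℂ) - n) • u)
      ∈ d.Onm n m := by
  induction a using d.homogeneous_induction with
  | add a b ha hb =>
    rw [map_add (d.star₂ m n n) a b, LinearMap.add_apply]
    exact add_mem ha hb
  | hom w a ha =>
    have key : ∀ i : ℕ, d.res (binomSeries (w + m) (m + i + 1)) a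
          (d.mode d.conformal 0 u + d.mode d.conformal 1 u + ((m : ℂ) - n) • u)
        = (d.mode d.conformal 0 (d.res (binomSeries (w + m) (m + i + 1)) a u)
          + d.mode d.conformal 1 (d.res (binomSeries (w + m) (m + i + 1)) a u)
          + ((m : ℂ) - n) • d.res (binomSeries (w + m) (m + i + 1)) a u)
          - ((i : ℂ) • d.res (binomSeries (w + m) (m + i + 1)) a u
            + ((m : ℂ) + i + 1) • d.res (binomSeries (w + m) (m + i + 1 + 1)) a u) := by
      intro i
      have h := binomSeries_succ (w + m - 1) (m + i + 1)
      rw [sub_add_cancel] at h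
      rw [mode_conformal_zero_res, d.mode_conformal_one_res _ ha, single_mul_binomSeries,
        hasseDeriv_one_binomSeries, hasseDeriv_one_binomSeries, sub_add_cancel, res_sub, res_sub,
        res_smul, res_smul, res_smul, res_smul]
      simp only [h, res_add, map_add, map_smul]
      push_cast
      module
    have h := sum_neg_one_pow_mul_choose_smul m n
      fun i => d.res (binomSeries (w + m) (m + i + 1)) a u
    rw [d.left_apply m n ha]
    simp only [key, smul_sub, Finset.sum_sub_distrib]
    refine sub_mem (Submodule.sum_mem _ fun i _ => Submodule.smul_mem _ _
      (d.translation_mem_Onm n m _)) ?_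
    push_cast at h
    simp only [← add_assoc] at h
    rw [h]
    refine Submodule.smul_mem _ _ (d.res_binomSeries_mem_Onm n m (le_refl 0) ha u (by simp) ?_)
    push_cast
    ring

theorem exists_forall_mode_eq_zero (d : VOA V) (r : ℤ) (u v : V) :
    ∃ n : ℕ, ∀ i : ℕ, n ≤ i → d.mode u (r + i) v = 0 := by
  obtain ⟨T, hT⟩ := d.truncation u v
  exact ⟨(T - r).toNat, fun i hi => hT _ (by omega)⟩

theorem left_circmn_mem_Onm (d : VOA V) (n m : ℕ) (a u v : V) :
    d.star₂ m n n a (d.circmn n m u v) ∈ d.Onm n m := by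
  rw [circmn, ← bresBilin_apply]
  induction a using d.homogeneous_induction with
  | add a b ha hb =>
    rw [map_add, LinearMap.add_apply]
    exact add_mem ha hb
  | hom wa a ha =>
  induction u using d.homogeneous_induction with
  | add u u' hu hu' =>
    rw [map_add, LinearMap.add_apply, map_add]
    exact add_mem hu hu'
  | hom wu u hu =>
  rw [bresBilin_apply, d.bres_of_mem _ _ hu, d.left_apply m n ha]
  refine Submodule.sum_mem _ fun i _ => Submodule.smul_mem _ _ ?_
  obtain ⟨j, hj⟩ := d.exists_forall_mode_eq_zero 0 a u
  obtain ⟨l, hl⟩ := d.borcherds_res 0 a u v (binomSeries (wa + m) (m + i + 1))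
    (binomSeries (wu + m) (n + m + 2)) hj
  simp only [Finset.sum_range_succ', cbinom_zero_succ, mul_zero, zero_smul, Finset.sum_const_zero,
    zero_add, cbinom_zero_right, pow_zero, zpow_zero, one_smul, mul_one, single_mul_binomSeries,
    Nat.cast_zero, sub_zero] at hl
  rw [← Submodule.sub_mem_iff_left _ (y := d.res (binomSeries (wu + m) (n + m + 2)) u _)
    (d.res_binomSeries_mem_Onm n m (le_refl 0) hu _ (by simp) (by simp)), ← hl]
  refine Submodule.sum_mem _ fun p _ => ?_
  have hp := d.grading_mode wa wu p a u ha hu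
  have h := hasseDeriv_binomSeries_mem_span (wa + m) (m + i + 1) p
  generalize hasseDeriv ℂ p (binomSeries (wa + m) (m + i + 1)) = f at h
  induction h using Submodule.span_induction with
  | mem f hf =>
    obtain ⟨q, rfl⟩ := hf
    simp only
    rw [binomSeries_mul]
    refine d.res_binomSeries_mem_Onm n m (s := m + 1 + q) (t := m + i + 1 + q) (by omega) hp v ?_ ?_
    <;>
    · push_cast
      ring
  | zero =>
    rw [zero_mul, res_zero]
    exact zero_mem _
  | add f g _ _ hf hg =>
    rw [add_mul, res_add]
    exact add_mem hf hg
  | smul c f _ hf =>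
    rw [smul_series_mul, res_smul]
    exact Submodule.smul_mem _ _ hf

theorem right_circmn_mem_Onm (d : VOA V) (n m : ℕ) (u v b : V) :
    d.star₂ m m n (d.circmn n m u v) b ∈ d.Onm n m := by
  rw [circmn, ← bresBilin_apply]
  induction u using d.homogeneous_induction with
  | add u u' hu hu' =>
    rw [map_add, LinearMap.add_apply, map_add, LinearMap.add_apply]
    exact add_mem hu hu'
  | hom wu u hu =>
  induction v using d.homogeneous_induction with
  | add v v' hv hv' =>
    rw [map_add, map_add, LinearMap.add_apply]
    exact add_mem hv hv'
  | hom wv v hv =>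
  obtain ⟨j, hj⟩ := d.exists_forall_mode_eq_zero (-(n + m + 2)) u v
  have huv : d.bresBilin m (n + m + 2) u v
      = ∑ p ∈ Finset.range j, cbinom (wu + m) p • d.mode u (-(n + m + 2) + p) v := by
    rw [bresBilin_apply, d.bres_of_mem _ _ hu, ← hres_eq_res, hres]
    simp only [neg_add_eq_sub]
    refine finsum_eq_sum_of_support_subset _ fun p hp => ?_
    by_contra hpj
    rw [Finset.mem_coe, Finset.mem_range, not_lt] at hpj
    apply hp
    simp only
    rw [← neg_add_eq_sub, hj p hpj, smul_zero]
  have hp : ∀ p : ℕ, d.mode u (-(n + m + 2) + p) v ∈ d.grading (wu + wv + n + m + 1 - p) := by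
    intro p
    have h := d.grading_mode wu wv (-(n + m + 2) + p) u v hu hv
    rwa [show wu + wv - (-((n : ℤ) + m + 2) + p) - 1 = wu + wv + n + m + 1 - p by ring] at h
  rw [huv, map_sum, LinearMap.sum_apply]
  simp only [map_smul, LinearMap.smul_apply, d.right_apply m n (hp _), Finset.smul_sum]
  rw [Finset.sum_comm]
  refine Submodule.sum_mem _ fun i _ => ?_
  simp only [smul_comm (cbinom _ _)]
  rw [← Finset.smul_sum]
  refine Submodule.smul_mem _ _ ?_
  obtain ⟨l, hl⟩ := d.borcherds_res (-(n + m + 2)) u v b (binomSeries (wu + m) 0)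
    (binomSeries (wv + m + n + 1) (n + i + 1)) hj
  have hterm : ∀ p : ℕ, cbinom (wu + m) p • d.res (binomSeries (wu + wv + n + m + 1 - p + m)
        (n + i + 1)) (d.mode u (-(n + m + 2) + p) v) b
      = d.res (hasseDeriv ℂ p (binomSeries (wu + m) 0)
        * binomSeries (wv + m + n + 1) (n + i + 1)) (d.mode u (-(n + m + 2) + p) v) b := by
    intro p
    rw [hasseDeriv_binomSeries_zero, smul_series_mul, binomSeries_mul, res_smul, zero_add]
    ring_nf
  simp only [hterm, hl, single_mul_binomSeries]
  refine Submodule.sum_mem _ fun q _ => Submodule.smul_mem _ _ (sub_mem ?_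
    (Submodule.smul_mem _ _ ?_))
  · refine d.res_binomSeries_mem_Onm n m (s := 0) (t := q) (by omega) hu _ ?_ ?_ <;>
    · push_cast
      ring
  · refine d.res_binomSeries_mem_Onm n m (s := n + 1) (t := n + i + 1 + q) (by omega) hv _ ?_ ?_ <;>
    · push_cast
      ring

/-! ### The vacuum acts as the identity -/

theorem left_vacuum (d : VOA V) (n m : ℕ) (x : V) : d.star₂ m n n d.vacuum x = x := by
  have h : ∀ f, d.res f d.vacuum x = f.coeff (-1) • x := by
    intro f
    rw [res_apply, finsum_eq_single _ (-1) fun p hp => ?_, d.vacuum_mode, if_pos rfl]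
    rw [d.vacuum_mode, if_neg hp, smul_zero]
  rw [d.left_apply m n d.vacuum_mem, Finset.sum_range_succ', Finset.sum_eq_zero fun i _ => ?_]
  · rw [h, coeff_binomSeries, if_neg (by omega), zero_add,
      show ((-1 : ℤ) + (m + (0 : ℕ) + 1)).natAbs = m by omega, zero_add, cbinom_natCast]
    simp
  · rw [h, coeff_binomSeries, if_neg (by omega), zero_add,
      show ((-1 : ℤ) + (m + (i + 1 : ℕ) + 1)).natAbs = m + i + 1 by omega, cbinom_natCast,
      Nat.choose_eq_zero_of_lt (show m < m + i + 1 by omega)]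
    simp

theorem mode_neg_vacuum_sub_mem_Onm (d : VOA V) (n m : ℕ) {w : ℤ} {x : V} (hx : x ∈ d.grading w)
    (j : ℕ) : d.mode x (-1 - j) d.vacuum - cbinom (n - m - w) j • x ∈ d.Onm n m := by
  induction j with
  | zero =>
    rw [cbinom_zero_right, Nat.cast_zero, sub_zero, d.creation_neg_one, one_smul, sub_self]
    exact zero_mem _
  | succ j ih =>
    have hy := d.grading_mode w 0 (-1 - j) x d.vacuum hx d.vacuum_mem
    have h := d.translation_mem_Onm n m (d.mode x (-1 - j) d.vacuum)
    rw [mode_conformal_zero_comm, d.L0_eigen _ _ hy, d.creation _ 0 le_rfl, map_zero] at h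
    have hj : (j : ℂ) + 1 ≠ 0 := Nat.cast_add_one_ne_zero j
    rw [← Submodule.smul_mem_iff _ hj]
    convert add_mem h (Submodule.smul_mem _ ((n : ℂ) - m - w - j) ih) using 1
    rw [smul_sub, ← smul_assoc _ (cbinom _ _), smul_eq_mul, succ_mul_cbinom_succ]
    push_cast
    rw [show (-1 : ℤ) - (j + 1) = -1 - j - 1 by ring]
    module

theorem res_vacuum_sub_mem_Onm (d : VOA V) (n m : ℕ) {w : ℤ} {x : V} (hx : x ∈ d.grading w)
    (f : ℂ⸨X⸩) : d.res f x d.vacuum - (f * binomSeries (n - m - w) 0).coeff (-1) • x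
      ∈ d.Onm n m := by
  obtain ⟨T, hT, hT0⟩ := ((d.eventually_res_eq_zero x d.vacuum).and
    (Filter.eventually_ge_atTop 0)).exists
  obtain ⟨K, hK⟩ := exists_isSuppGE f
  refine IsSuppGE.induction (T := T) (P := fun f => d.res f x d.vacuum
    - (f * binomSeries (n - m - w) 0).coeff (-1) • x ∈ d.Onm n m)
    (fun f hf => ?_) (fun p _ => ?_) (fun f g hf hg => ?_) (fun c f hf => ?_) hK
  · rw [hT f hf, hf.mul (isSuppGE_binomSeries _ _) (-1) (by omega), zero_smul, sub_zero]
    exact zero_mem _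
  · rw [res_single, single_mul_binomSeries, coeff_binomSeries]
    rcases le_or_gt 0 p with hp | hp
    · rw [d.creation _ _ hp, if_pos (by omega), zero_smul, sub_zero]
      exact zero_mem _
    · have h := d.mode_neg_vacuum_sub_mem_Onm n m hx (-1 - p).natAbs
      rw [if_neg (by omega)]
      convert h using 4 <;> omega
  · convert add_mem hf hg using 1
    rw [res_add, add_mul, HahnSeries.coeff_add]
    module
  · convert Submodule.smul_mem _ c hf using 1
    rw [res_smul, smul_series_mul, HahnSeries.coeff_smul, smul_eq_mul]
    module

theorem right_vacuum_sub_mem_Onm (d : VOA V) (n m : ℕ) (x : V) :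
    d.star₂ m m n x d.vacuum - x ∈ d.Onm n m := by
  induction x using d.homogeneous_induction with
  | add x y hx hy =>
    convert add_mem hx hy using 1
    rw [map_add, LinearMap.add_apply]
    abel
  | hom w x hx =>
    have h : x = ∑ i ∈ Finset.range (m + 1), ((-1 : ℂ) ^ i * (n + i).choose i) •
        ((binomSeries (w + m) (n + i + 1) * binomSeries (n - m - w) 0).coeff (-1) • x) := by
      rw [Finset.sum_range_succ', Finset.sum_eq_zero fun i _ => ?_]
      · rw [binomSeries_mul, coeff_binomSeries, if_neg (by omega), zero_add,
          show w + m + ((n : ℤ) - m - w) = n by ring,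
          show ((-1 : ℤ) + (n + (0 : ℕ) + 1 + 0)).natAbs = n by omega, cbinom_natCast]
        simp
      · rw [binomSeries_mul, coeff_binomSeries, if_neg (by omega),
          show w + m + ((n : ℤ) - m - w) = n by ring,
          show ((-1 : ℤ) + (n + (i + 1 : ℕ) + 1 + 0)).natAbs = n + i + 1 by omega, cbinom_natCast,
          Nat.choose_eq_zero_of_lt (show n < n + i + 1 by omega)]
        simp
    nth_rewrite 2 [h]
    rw [d.right_apply m n hx, ← Finset.sum_sub_distrib]
    refine Submodule.sum_mem _ fun i _ => ?_
    rw [← smul_sub]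
    exact Submodule.smul_mem _ _ (d.res_vacuum_sub_mem_Onm n m hx _)

/-! ### Associativity and stability of `Onm` -/

theorem assoc_sub_mem_Onm (d : VOA V) (n m p₁ p₂ : ℕ) (a b c : V) :
    d.star₂ m p₁ n (d.star₂ p₁ p₂ n a b) c - d.star₂ m p₂ n a (d.star₂ m p₁ p₂ b c)
      ∈ d.Onm n m := by
  simpa only [left_vacuum] using d.assoc_mem_Onm n m d.vacuum a b c p₁ p₂ n

theorem left_mem_Onm (d : VOA V) (n m : ℕ) (a : V) {x : V} (hx : x ∈ d.Onm n m) :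
    d.star₂ m n n a x ∈ d.Onm n m := by
  induction hx using Submodule.span_induction with
  | mem x hx =>
    rcases hx with ((⟨u, v, rfl⟩ | ⟨u, rfl⟩) | ⟨u, b, b', c, p₁, p₂, p₃, rfl⟩) |
      ⟨p, u, y, v, hy, rfl⟩
    · exact d.left_circmn_mem_Onm n m a u v
    · exact d.left_translation_mem_Onm n m a u
    · simp only [starmpn_eq]
      exact (Submodule.sub_mem_iff_right _ (d.assoc_mem_Onm n m _ b b' c p₁ p₂ p₃)).mp
        (d.assoc_sub_mem_Onm n m p₃ n a u _)
    · simp only [starmpn_eq]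
      have h₁ := (Submodule.sub_mem_iff_right _
        (d.mul_On_mul_mem_Onm n m (d.star₂ p n n a u) v hy)).mp (d.assoc_sub_mem_Onm n m p p _ y v)
      have h₂ := (Submodule.sub_mem_iff_right _ h₁).mp
        (d.assoc_sub_mem_Onm n m p n a u (d.star₂ m p p y v))
      have h₃ := d.assoc_mem_Onm n m a u y v p p n
      rw [map_sub] at h₃
      exact (Submodule.sub_mem_iff_left _ h₂).mp h₃
  | zero =>
    rw [map_zero]
    exact zero_mem _
  | add x y _ _ hx hy =>
    rw [map_add]
    exact add_mem hx hy
  | smul c x _ hx =>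
    rw [map_smul]
    exact Submodule.smul_mem _ c hx

theorem right_mem_Onm (d : VOA V) (n m : ℕ) {x : V} (hx : x ∈ d.Onm n m) (a : V) :
    d.star₂ m m n x a ∈ d.Onm n m := by
  induction hx using Submodule.span_induction with
  | mem x hx =>
    rcases hx with ((⟨u, v, rfl⟩ | ⟨u, rfl⟩) | ⟨u, b, b', c, p₁, p₂, p₃, rfl⟩) |
      ⟨p, u, y, v, hy, rfl⟩
    · exact d.right_circmn_mem_Onm n m u v a
    · exact d.right_translation_mem_Onm n m u a
    · simp only [starmpn_eq]
      refine (Submodule.sub_mem_iff_left _ ?_).mp (d.assoc_sub_mem_Onm n m m p₃ u _ a)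
      have h₁ := d.assoc_mem_Onm n m u (d.star₂ p₁ p₂ p₃ b b') c a m p₁ p₃
      have h₂ := d.assoc_mem_Onm n m u b (d.star₂ m p₁ p₂ b' c) a m p₂ p₃
      have h₃ := d.assoc_mem_Onm n m u b b' (d.star₂ m m p₁ c a) p₁ p₂ p₃
      have h₄ := (Submodule.sub_mem_iff_right _
        (d.assoc_mem_Onm n m (d.star₂ p₂ p₃ n u b) b' c a m p₁ p₂)).mp
        (d.assoc_sub_mem_Onm n m p₂ p₃ u b _)
      convert sub_mem (add_mem (sub_mem h₁ h₂) h₃) h₄ using 1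
      simp only [map_sub, LinearMap.sub_apply]
      abel
    · simp only [starmpn_eq]
      exact (Submodule.sub_mem_iff_left _ (d.mul_On_mul_mem_Onm n m u _ hy)).mp
        (d.assoc_sub_mem_Onm n m m p _ v a)
  | zero =>
    rw [map_zero, LinearMap.zero_apply]
    exact zero_mem _
  | add x y _ _ hx hy =>
    rw [map_add, LinearMap.add_apply]
    exact add_mem hx hy
  | smul c x _ hx =>
    rw [map_smul, LinearMap.smul_apply]
    exact Submodule.smul_mem _ c hx

end VOA

/-- `A_{n,m}(V) = V/O_{n,m}(V)` is an `A_n(V)`-`A_m(V)`-bimodule, with left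
action induced by `*̄_m^n = *_{m,n}^n` and right action induced by `*_m^n = *_{m,m}^n`:
both actions preserve `O_{n,m}(V)`, kill `O_n(V)` resp. `O_m(V)`, are associative for the
products `*_n` resp. `*_m`, commute with each other, and the vacuum acts as identity. -/
theorem stmt15 (d : VOA V) (n m : ℕ) :
    (∀ a x : V, a ∈ d.On n → d.starmpn m n n a x ∈ d.Onm n m) ∧
    (∀ a x : V, x ∈ d.Onm n m → d.starmpn m n n a x ∈ d.Onm n m) ∧
    (∀ x a : V, x ∈ d.Onm n m → d.starmpn m m n x a ∈ d.Onm n m) ∧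
    (∀ x a : V, a ∈ d.On m → d.starmpn m m n x a ∈ d.Onm n m) ∧
    (∀ a b x : V,
      d.starmpn m n n (d.starn n a b) x - d.starmpn m n n a (d.starmpn m n n b x)
        ∈ d.Onm n m) ∧
    (∀ x a b : V,
      d.starmpn m m n (d.starmpn m m n x a) b - d.starmpn m m n x (d.starn m a b)
        ∈ d.Onm n m) ∧
    (∀ a x b : V,
      d.starmpn m m n (d.starmpn m n n a x) b - d.starmpn m n n a (d.starmpn m m n x b)
        ∈ d.Onm n m) ∧
    (∀ x : V, d.starmpn m n n d.vacuum x - x ∈ d.Onm n m) ∧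
    (∀ x : V, d.starmpn m m n x d.vacuum - x ∈ d.Onm n m) := by
  simp only [VOA.starmpn_eq, VOA.starn_eq]
  refine ⟨fun a x ha => ?_, fun a x hx => d.left_mem_Onm n m a hx,
    fun x a hx => d.right_mem_Onm n m hx a, fun x a ha => ?_, d.assoc_sub_mem_Onm n m n n,
    d.assoc_sub_mem_Onm n m m m, d.assoc_sub_mem_Onm n m m n, fun x => ?_,
    d.right_vacuum_sub_mem_Onm n m⟩
  · simpa only [VOA.left_vacuum] using d.mul_On_mul_mem_Onm n m d.vacuum x ha
  · exact (Submodule.sub_mem_iff_right _ (d.mul_On_mul_mem_Onm n m x d.vacuum ha)).mp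
      (d.right_vacuum_sub_mem_Onm n m _)
  · rw [d.left_vacuum, sub_self]
    exact zero_mem _
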